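/- Let T be a binary tree with n leaves, let c(T) be its number of cherries, and for 0 ≤ s ≤ n/2 let μ(s) = 2^s 1^{n-2s} be the partition of n consisting of s twos and n−2s ones. Then the number of automorphisms of T with cycle type μ(s) satisfies |A(T)_{μ(s)}| ≤ binom(c(T)+s−1, s). -/

import Mathlib

open scoped Classical

inductive PTree : Type
  | leaf : PTree
  | node : PTree → PTree → PTree
deriving DecidableEq

namespace PTree

def size : PTree → ℕ
  | leaf => 1
  | node l r => size l + size r

def cherries : PTree → ℕ
  | leaf => 0
  | node leaf leaf => 1
  | node l r => cherries l + cherries r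

def height : PTree → ℕ
  | leaf => 0
  | node l r => max (height l) (height r) + 1

def encode : PTree → ℕ
  | leaf => 0
  | node l r => Nat.pair (encode l) (encode r) + 1

def normalize : PTree → PTree
  | leaf => leaf
  | node l r =>
      let l' := normalize l
      let r' := normalize r
      if encode l' ≤ encode r' then node l' r' else node r' l'

def isoFuns : PTree → PTree → List (ℕ → ℕ)
  | leaf, leaf => [fun i => i]
  | node l r, node l' r' =>
      ((isoFuns l l').flatMap fun g => (isoFuns r r').map fun h =>
        fun i => if i < l.size then g i else h (i - l.size) + l'.size)
      ++
      ((isoFuns l r').flatMap fun g => (isoFuns r l').map fun h =>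
        fun i => if i < l.size then g i + l'.size else h (i - l.size))
  | _, _ => []

def planeTrees : ℕ → Finset PTree
  | 0 => ∅
  | 1 => {leaf}
  | n + 2 =>
      (Finset.range (n + 1)).attach.biUnion fun k =>
        ((planeTrees (k.1 + 1)) ×ˢ (planeTrees (n + 1 - k.1))).image
          fun p => node p.1 p.2
  termination_by n => n
  decreasing_by
  · have := Finset.mem_range.mp k.2; omega
  · omega

def binTrees (n : ℕ) : Finset PTree := (planeTrees n).image normalize

/-- Triples (T, v, S): left plane tree, right plane tree, and a matching `v`
(a permutation of `0, …, n-1`, encoded as the list of its values) matching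
leaf `i` of `T` with leaf `v i` of `S`. -/
def Triples (n : ℕ) : Finset (PTree × PTree × List ℕ) :=
  (planeTrees n) ×ˢ ((planeTrees n) ×ˢ (List.range n).permutations.toFinset)

/-- Two triples represent the same tanglegram iff there are isomorphisms of the left
trees and of the right trees compatible with the matchings. -/
def equivTriple (n : ℕ) (t t' : PTree × PTree × List ℕ) : Bool :=
  (isoFuns t.1 t'.1).any fun φ => (isoFuns t.2.1 t'.2.1).any fun ψ =>
    (List.range n).all fun i => t'.2.2.getD (φ i) 0 == ψ (t.2.2.getD i 0)

/-- The tanglegrams of size `n`: equivalence classes of triples. -/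
def tangleClasses (n : ℕ) : Finset (Finset (PTree × PTree × List ℕ)) :=
  (Triples n).image fun t => (Triples n).filter (fun t' => equivTriple n t t' = true)

/-- The number of tanglegrams of size `n`. -/
def numTanglegrams (n : ℕ) : ℕ := (tangleClasses n).card

/-- The probability that a uniformly random tanglegram of size `n` satisfies the
(isomorphism-invariant) property `P` of triples. -/
noncomputable def tangleProb (n : ℕ) (P : PTree × PTree × List ℕ → Prop) : ℝ :=
  ((tangleClasses n).filter fun c => ∃ t ∈ c, P t).card / numTanglegrams n

/-- The expectation of the statistic `f` of a uniformly random tanglegram of size `n`. -/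
noncomputable def tangleExp (n : ℕ) (f : PTree × PTree × List ℕ → ℕ) : ℝ :=
  ∑' k : ℕ, (k : ℝ) * tangleProb n (fun t => f t = k)

end PTree

namespace PTree

/-- The distribution on pairs of binary trees (canonical representatives) induced by
the two halves of a uniformly random tanglegram of size `n`:
probability that the pair of isomorphism classes of the two trees lies in `S`. -/
noncomputable def nuT (n : ℕ) (S : Finset (PTree × PTree)) : ℝ :=
  tangleProb n fun t => (normalize t.1, normalize t.2.1) ∈ S

/-- The distribution on pairs of binary trees induced by two independent uniformly
random plane binary trees with `n` leaves. -/
noncomputable def nuP (n : ℕ) (S : Finset (PTree × PTree)) : ℝ :=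
  (((planeTrees n) ×ˢ (planeTrees n)).filter
      fun p => (normalize p.1, normalize p.2) ∈ S).card / ((planeTrees n).card ^ 2 : ℝ)

/-- The total variation distance between `nuT` and `nuP`. -/
noncomputable def tvDist (n : ℕ) : ℝ :=
  ((binTrees n ×ˢ binTrees n).powerset).sup' (Finset.powerset_nonempty _)
    fun S => |nuT n S - nuP n S|

/-- The number of occurrences of (trees isomorphic to) `B` as a fringe subtree of `T`. -/
def occ (B : PTree) : PTree → ℕ
  | leaf => if normalize leaf = normalize B then 1 else 0
  | node l r => (if normalize (node l r) = normalize B then 1 else 0) + occ B l + occ B r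

/-- The number of generators of the automorphism group of `T`: the number of internal
vertices whose two branches are isomorphic. -/
def gens : PTree → ℕ
  | leaf => 0
  | node l r => (if normalize l = normalize r then 1 else 0) + gens l + gens r

/-- `T` has a root branch isomorphic to `B`. -/
def hasBranch (B : PTree) : PTree → Prop
  | leaf => False
  | node l r => normalize l = normalize B ∨ normalize r = normalize B

/-- The cherries of a plane binary tree whose leaves are numbered from `k` on
(left to right), as pairs of leaf positions. -/
def cherryList : PTree → ℕ → List (ℕ × ℕ)
  | leaf, _ => []
  | node leaf leaf, k => [(k, k + 1)]
  | node l r, k => cherryList l k ++ cherryList r (k + l.size)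

/-- The number of matched cherries: cherries of `T` whose two leaves are matched by `L`
to the two leaves of a cherry of `S`. -/
def matchedCherries (T S : PTree) (L : List ℕ) : ℕ :=
  (cherryList T 0).countP fun p =>
    (cherryList S 0).any fun q =>
      (L.getD p.1 0 == q.1 && L.getD p.2 0 == q.2) ||
      (L.getD p.1 0 == q.2 && L.getD p.2 0 == q.1)

/-- The number of automorphisms of the tanglegram represented by the triple `(T, L, S)`:
pairs of automorphisms of the two trees compatible with the matching `L`. -/
def tangleAutCount (T S : PTree) (L : List ℕ) : ℕ :=
  ((isoFuns T T).map fun a =>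
    (isoFuns S S).countP fun b =>
      (List.range T.size).all fun i => L.getD (a i) 0 == b (L.getD i 0)).sum

/-- The number of automorphisms of `T` whose cycle type is `μ(s) = 2^s 1^(n-2s)`,
i.e. involutions of the leaves moving exactly `2 s` leaves. -/
def autMuCount (T : PTree) (s : ℕ) : ℕ :=
  (isoFuns T T).countP fun f =>
    ((List.range T.size).all fun i => f (f i) == i) &&
    ((List.range T.size).countP fun i => !(f i == i)) == 2 * s

end PTree

namespace PTree

lemma size_pos (T : PTree) : 0 < T.size := by
  induction T with
  | leaf => simp [size]
  | node l r ihl ihr => simp only [size]; omega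

lemma cherries_node_of_ne {l r : PTree} (h : ¬(l = leaf ∧ r = leaf)) :
    (node l r).cherries = l.cherries + r.cherries := by
  cases l <;> cases r <;> simp_all [cherries]

lemma one_le_cherries {T : PTree} (h : T ≠ leaf) : 1 ≤ T.cherries := by
  induction T with
  | leaf => exact absurd rfl h
  | node l r ihl ihr =>
    by_cases hlr : l = leaf ∧ r = leaf
    · obtain ⟨rfl, rfl⟩ := hlr; simp [cherries]
    · rw [cherries_node_of_ne hlr]
      by_cases hl : l = leaf
      · have := ihr fun hr => hlr ⟨hl, hr⟩
        omega
      · have := ihl hl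
        omega

lemma two_mul_cherries_le_size (T : PTree) : 2 * T.cherries ≤ T.size := by
  induction T with
  | leaf => simp [cherries]
  | node l r ihl ihr =>
    by_cases hlr : l = leaf ∧ r = leaf
    · obtain ⟨rfl, rfl⟩ := hlr; simp [cherries, size]
    · rw [cherries_node_of_ne hlr, size]; omega

/-- The isomorphism of `node l r` acting by `g` on the leaves of `l` and by `h` on those of `r`,
where `m` is the size of `l` and `k` the size of the image of `l`. -/
def joinFun (m k : ℕ) (g h : ℕ → ℕ) : ℕ → ℕ :=
  fun i => if i < m then g i else h (i - m) + k

/-- The isomorphism of `node l r` acting by `g` on the leaves of `l` and by `h` on those of `r`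
and exchanging the two branches, where `m` is the size of `l` and `k` the size of the image
of `r`. -/
def swapFun (m k : ℕ) (g h : ℕ → ℕ) : ℕ → ℕ :=
  fun i => if i < m then g i + k else h (i - m)

lemma joinFun_left {m k : ℕ} {g h : ℕ → ℕ} {i : ℕ} (hi : i < m) :
    joinFun m k g h i = g i := if_pos hi

lemma joinFun_right {m k : ℕ} {g h : ℕ → ℕ} (i : ℕ) :
    joinFun m k g h (m + i) = h i + k := by simp [joinFun]

lemma swapFun_left {m k : ℕ} {g h : ℕ → ℕ} {i : ℕ} (hi : i < m) :
    swapFun m k g h i = g i + k := if_pos hi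

lemma swapFun_right {m k : ℕ} {g h : ℕ → ℕ} (i : ℕ) :
    swapFun m k g h (m + i) = h i := by simp [swapFun]

lemma isoFuns_node_node (l r l' r' : PTree) :
    isoFuns (node l r) (node l' r') =
      ((isoFuns l l').flatMap fun g => (isoFuns r r').map (joinFun l.size l'.size g)) ++
      ((isoFuns l r').flatMap fun g => (isoFuns r l').map (swapFun l.size l'.size g)) := rfl

lemma mem_isoFuns_node {l r l' r' : PTree} {f : ℕ → ℕ}
    (hf : f ∈ isoFuns (node l r) (node l' r')) :
    (∃ g ∈ isoFuns l l', ∃ h ∈ isoFuns r r', f = joinFun l.size l'.size g h) ∨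
    (∃ g ∈ isoFuns l r', ∃ h ∈ isoFuns r l', f = swapFun l.size l'.size g h) := by
  simp only [isoFuns_node_node, List.mem_append, List.mem_flatMap, List.mem_map] at hf
  rcases hf with ⟨g, hg, h, hh, rfl⟩ | ⟨g, hg, h, hh, rfl⟩
  · exact Or.inl ⟨g, hg, h, hh, rfl⟩
  · exact Or.inr ⟨g, hg, h, hh, rfl⟩

lemma isoFuns_eq_nil_of_leaf {S T : PTree} (h : ¬(S = leaf ↔ T = leaf)) : isoFuns S T = [] := by
  cases S <;> cases T <;> simp_all [isoFuns]

lemma leaf_iff_of_mem_isoFuns {S T : PTree} {f : ℕ → ℕ} (hf : f ∈ isoFuns S T) :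
    S = leaf ↔ T = leaf := by
  by_contra h
  simp [isoFuns_eq_nil_of_leaf h] at hf

lemma size_eq_of_mem_isoFuns {S T : PTree} {f : ℕ → ℕ} (hf : f ∈ isoFuns S T) :
    S.size = T.size := by
  induction S generalizing T f with
  | leaf => rw [(leaf_iff_of_mem_isoFuns hf).1 rfl]
  | node l r ihl ihr =>
    cases T with
    | leaf => simp [isoFuns] at hf
    | node l' r' =>
      rcases mem_isoFuns_node hf with ⟨g, hg, h, hh, -⟩ | ⟨g, hg, h, hh, -⟩ <;>
      · have := ihl hg
        have := ihr hh
        simp only [size]; omega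

lemma cherries_eq_of_mem_isoFuns {S T : PTree} {f : ℕ → ℕ} (hf : f ∈ isoFuns S T) :
    S.cherries = T.cherries := by
  induction S generalizing T f with
  | leaf => rw [(leaf_iff_of_mem_isoFuns hf).1 rfl]
  | node l r ihl ihr =>
    cases T with
    | leaf => simp [isoFuns] at hf
    | node l' r' =>
      rcases mem_isoFuns_node hf with ⟨g, hg, h, hh, -⟩ | ⟨g, hg, h, hh, -⟩ <;>
      · have hg' := leaf_iff_of_mem_isoFuns hg
        have hh' := leaf_iff_of_mem_isoFuns hh
        have := ihl hg
        have := ihr hh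
        by_cases hlr : l = leaf ∧ r = leaf
        · obtain ⟨rfl, rfl⟩ := hlr
          rw [hg'.1 rfl, hh'.1 rfl]
        · rw [cherries_node_of_ne hlr, cherries_node_of_ne (by tauto)]
          omega

lemma lt_size_of_mem_isoFuns {S T : PTree} {f : ℕ → ℕ} (hf : f ∈ isoFuns S T) {i : ℕ}
    (hi : i < S.size) : f i < T.size := by
  induction S generalizing T f i with
  | leaf =>
    obtain rfl := (leaf_iff_of_mem_isoFuns hf).1 rfl
    simp only [isoFuns, List.mem_singleton] at hf
    simpa [hf] using hi
  | node l r ihl ihr =>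
    cases T with
    | leaf => simp [isoFuns] at hf
    | node l' r' =>
      simp only [size] at hi ⊢
      rcases mem_isoFuns_node hf with ⟨g, hg, h, hh, rfl⟩ | ⟨g, hg, h, hh, rfl⟩
      · rcases lt_or_ge i l.size with hil | hil
        · have := ihl hg hil
          rw [joinFun_left hil]; omega
        · obtain ⟨j, rfl⟩ := Nat.exists_eq_add_of_le hil
          have := ihr hh (i := j) (by omega)
          rw [joinFun_right]; omega
      · rcases lt_or_ge i l.size with hil | hil
        · have := ihl hg hil
          rw [swapFun_left hil]; omega
        · obtain ⟨j, rfl⟩ := Nat.exists_eq_add_of_le hil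
          have := ihr hh (i := j) (by omega)
          rw [swapFun_right]; omega

/-- Counting in a list of functions of two variables, when the counted property forces one of
finitely many combinations of properties of the variables. -/
lemma countP_flatMap_map_le {α β γ ι : Type*} (L : List α) (M : List β) (F : α → β → γ)
    (P : γ → Prop) (s : Finset ι) (A : ι → α → Prop) (B : ι → β → Prop)
    [DecidablePred P] [∀ t, DecidablePred (A t)] [∀ t, DecidablePred (B t)]
    (h : ∀ x ∈ L, ∀ y ∈ M, P (F x y) → ∃ t ∈ s, A t x ∧ B t y) :
    (L.flatMap fun x => M.map (F x)).countP (fun z => decide (P z)) ≤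
      ∑ t ∈ s, L.countP (fun x => decide (A t x)) * M.countP (fun y => decide (B t y)) := by
  induction L with
  | nil => simp
  | cons x L ih =>
    have hM : ∀ N : List β, (∀ y ∈ N, y ∈ M) →
        (N.map (F x)).countP (fun z => decide (P z)) ≤
          ∑ t ∈ s, (if A t x then 1 else 0) * N.countP (fun y => decide (B t y)) := by
      intro N hN
      induction N with
      | nil => simp
      | cons y N ihN =>
        have h1 := ihN fun z hz => hN z (List.mem_cons_of_mem _ hz)
        have h2 : (if P (F x y) then 1 else 0) ≤
            ∑ t ∈ s, (if A t x then 1 else 0) * (if B t y then 1 else 0) := by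
          split_ifs with hP
          · obtain ⟨t, ht, hA, hB⟩ := h x List.mem_cons_self y (hN y List.mem_cons_self) hP
            refine le_trans ?_ (Finset.single_le_sum (fun i _ => Nat.zero_le _) ht)
            simp [hA, hB]
          · exact Nat.zero_le _
        simp only [List.map_cons, List.countP_cons, decide_eq_true_eq, mul_add,
          Finset.sum_add_distrib]
        exact add_le_add h1 h2
    have h1 := ih fun x hx => h x (List.mem_cons_of_mem _ hx)
    have h2 := hM M fun _ hy => hy
    simp only [List.flatMap_cons, List.countP_append, List.countP_cons, decide_eq_true_eq, add_mul,
      Finset.sum_add_distrib]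
    omega

lemma countP_le_of_imp {α : Type*} {L : List α} {P Q : α → Prop} [DecidablePred P]
    [DecidablePred Q] (h : ∀ x ∈ L, P x → Q x) :
    L.countP (fun x => decide (P x)) ≤ L.countP (fun x => decide (Q x)) :=
  List.countP_mono_left fun x hx => by simpa using h x hx

/-- An isomorphism is determined by its values on the leaves. -/
lemma countP_isoFuns_eqOn_le_one (S T : PTree) (k : ℕ → ℕ) :
    (isoFuns S T).countP (fun f => decide (∀ i < S.size, f i = k i)) ≤ 1 := by
  induction S generalizing T k with
  | leaf => cases T <;> simp [isoFuns, List.countP_singleton] ; split_ifs <;> simp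
  | node l r ihl ihr =>
    cases T with
    | leaf => simp [isoFuns]
    | node l' r' =>
      rw [isoFuns_node_node, List.countP_append]
      have hl0 := size_pos l
      by_cases hk : k 0 < l'.size
      · have h1 := countP_flatMap_map_le (isoFuns l l') (isoFuns r r')
          (joinFun l.size l'.size) (fun f => ∀ i < (node l r).size, f i = k i) {()}
          (fun _ g => ∀ i < l.size, g i = k i)
          (fun _ h => ∀ i < r.size, h i = k (l.size + i) - l'.size) (by
            intro g _ h _ hf
            refine ⟨(), by simp, fun i hi => ?_, fun i hi => ?_⟩
            · rw [← hf i (by rw [size]; omega), joinFun_left hi]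
            · rw [← hf (l.size + i) (by rw [size]; omega), joinFun_right]; omega)
        have h2 : ((isoFuns l r').flatMap fun g =>
            (isoFuns r l').map (swapFun l.size l'.size g)).countP
            (fun f => decide (∀ i < (node l r).size, f i = k i)) = 0 := by
          simp only [List.countP_eq_zero, List.mem_flatMap, List.mem_map, decide_eq_true_eq]
          rintro _ ⟨g, hg, h, hh, rfl⟩ hf
          have := hf 0 (size_pos _)
          rw [swapFun_left hl0] at this
          omega
        rw [h2, add_zero]
        refine h1.trans ?_
        simpa using Nat.mul_le_mul (ihl l' k) (ihr r' fun i => k (l.size + i) - l'.size)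
      · have h1 := countP_flatMap_map_le (isoFuns l r') (isoFuns r l')
          (swapFun l.size l'.size) (fun f => ∀ i < (node l r).size, f i = k i) {()}
          (fun _ g => ∀ i < l.size, g i = k i - l'.size)
          (fun _ h => ∀ i < r.size, h i = k (l.size + i)) (by
            intro g _ h _ hf
            refine ⟨(), by simp, fun i hi => ?_, fun i hi => ?_⟩
            · rw [← hf i (by rw [size]; omega), swapFun_left hi]; omega
            · rw [← hf (l.size + i) (by rw [size]; omega), swapFun_right])
        have h2 : ((isoFuns l l').flatMap fun g =>
            (isoFuns r r').map (joinFun l.size l'.size g)).countP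
            (fun f => decide (∀ i < (node l r).size, f i = k i)) = 0 := by
          simp only [List.countP_eq_zero, List.mem_flatMap, List.mem_map, decide_eq_true_eq]
          rintro _ ⟨g, hg, h, hh, rfl⟩ hf
          have := hf 0 (size_pos _)
          rw [joinFun_left hl0] at this
          have := lt_size_of_mem_isoFuns hg hl0
          omega
        rw [h2, zero_add]
        refine h1.trans ?_
        simpa using Nat.mul_le_mul (ihl r' fun i => k i - l'.size) (ihr l' fun i => k (l.size + i))

lemma length_isoFuns_node_node (l r l' r' : PTree) :
    (isoFuns (node l r) (node l' r')).length =
      (isoFuns l l').length * (isoFuns r r').length +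
      (isoFuns l r').length * (isoFuns r l').length := by
  simp [isoFuns_node_node, List.length_flatMap]

lemma length_isoFuns_leaf_le (T : PTree) : (isoFuns leaf T).length ≤ 1 := by
  cases T <;> simp [isoFuns]

/-- The number of isomorphisms from a tree that is not a leaf is at most `2 ^ (2 c - 1)`, where
`c` is the number of cherries. -/
lemma two_mul_length_isoFuns_le {S : PTree} (hS : S ≠ leaf) (T : PTree) :
    2 * (isoFuns S T).length ≤ 4 ^ S.cherries := by
  induction S generalizing T with
  | leaf => exact absurd rfl hS
  | node l r ihl ihr =>
    cases T with
    | leaf => simp [isoFuns]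
    | node l' r' =>
      rw [length_isoFuns_node_node]
      by_cases hl : l = leaf <;> by_cases hr : r = leaf
      · subst hl hr
        have h1 := Nat.mul_le_mul (length_isoFuns_leaf_le l') (length_isoFuns_leaf_le r')
        have h2 := Nat.mul_le_mul (length_isoFuns_leaf_le r') (length_isoFuns_leaf_le l')
        simp only [cherries]; omega
      · rw [cherries_node_of_ne (by tauto)]
        subst hl
        have h1 := Nat.mul_le_mul (length_isoFuns_leaf_le l') (ihr hr r')
        have h2 := Nat.mul_le_mul (length_isoFuns_leaf_le r') (ihr hr l')
        simp only [cherries, zero_add]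
        by_cases hl' : l' = leaf
        · subst hl'
          rw [isoFuns_eq_nil_of_leaf (S := r) (T := leaf) (by tauto)]
          simp only [List.length_nil]; linarith
        · rw [isoFuns_eq_nil_of_leaf (S := leaf) (T := l') (by tauto)]
          simp only [List.length_nil]; linarith
      · rw [cherries_node_of_ne (by tauto)]
        subst hr
        have h1 := Nat.mul_le_mul (ihl hl l') (length_isoFuns_leaf_le r')
        have h2 := Nat.mul_le_mul (ihl hl r') (length_isoFuns_leaf_le l')
        simp only [cherries, add_zero]
        by_cases hl' : l' = leaf
        · subst hl'
          rw [isoFuns_eq_nil_of_leaf (S := l) (T := leaf) (by tauto)]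
          simp only [List.length_nil]; linarith
        · rw [isoFuns_eq_nil_of_leaf (S := leaf) (T := l') (by tauto)]
          simp only [List.length_nil]; linarith
      · rw [cherries_node_of_ne (by tauto), pow_add]
        have h1 := Nat.mul_le_mul (ihl hl l') (ihr hr r')
        have h2 := Nat.mul_le_mul (ihl hl r') (ihr hr l')
        linarith

lemma multichoose_mono_right {c : ℕ} (hc : 1 ≤ c) : Monotone (Nat.multichoose c) := by
  obtain ⟨d, rfl⟩ := Nat.exists_eq_add_of_le' hc
  refine monotone_nat_of_le_succ fun k => ?_
  rw [Nat.multichoose_succ_succ]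
  exact Nat.le_add_left _ _

lemma four_pow_le_choose (d : ℕ) : 4 ^ d ≤ (3 * d + 2).choose d := by
  induction d with
  | zero => simp
  | succ d ih =>
    have h : (3 * d + 2).choose d ≤ (3 * d + 2).choose (d + 1) :=
      Nat.choose_le_succ_of_lt_half_left (by omega)
    have e : 3 * (d + 1) + 2 = 3 * d + 2 + 1 + 1 + 1 := by ring
    rw [e, pow_succ]
    have h1 := Nat.choose_succ_succ' (3 * d + 2 + 1 + 1) d
    have h2 := Nat.choose_succ_succ' (3 * d + 2 + 1) d
    have h3 := Nat.choose_succ_succ' (3 * d + 2) d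
    have h4 := Nat.choose_le_choose d (show 3 * d + 2 ≤ 3 * d + 2 + 1 by omega)
    have h5 := Nat.choose_le_choose d (show 3 * d + 2 ≤ 3 * d + 2 + 1 + 1 by omega)
    linarith

lemma four_pow_le_multichoose {c n : ℕ} (hc : 1 ≤ c) (hn : 2 * c ≤ n) :
    4 ^ c ≤ 4 * Nat.multichoose c n := by
  refine le_trans ?_ (Nat.mul_le_mul_left 4 (multichoose_mono_right hc hn))
  obtain ⟨d, rfl⟩ := Nat.exists_eq_add_of_le' hc
  rw [Nat.multichoose_eq, pow_succ, mul_comm]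
  refine Nat.mul_le_mul_left 4 ((four_pow_le_choose d).trans_eq ?_)
  rw [show d + 1 + 2 * (d + 1) - 1 = 3 * d + 2 by omega,
    ← Nat.choose_symm (n := 3 * d + 2) (k := d) (by omega)]
  congr 1; omega

open PowerSeries in
/-- The Chu-Vandermonde identity for multiset coefficients. -/
lemma sum_antidiagonal_multichoose (a b s : ℕ) :
    ∑ p ∈ Finset.HasAntidiagonal.antidiagonal s, Nat.multichoose a p.1 * Nat.multichoose b p.2 =
      Nat.multichoose (a + b) s := by
  have key : ∀ c : ℕ, (mk fun k => (Nat.multichoose c k : ℤ)) * (1 - X) ^ c = 1 := by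
    intro c
    induction c with
    | zero =>
      ext k
      cases k <;> simp [coeff_one]
    | succ c ih =>
      rw [pow_succ', ← mul_assoc]
      refine Eq.trans (congrArg (· * (1 - X : PowerSeries ℤ) ^ c) ?_) ih
      ext k
      cases k with
      | zero => simp [mul_sub]
      | succ k => simp [mul_sub, coeff_succ_mul_X, Nat.multichoose_succ_succ]
  have hmul : (mk fun k => (Nat.multichoose a k : ℤ)) * (mk fun k => (Nat.multichoose b k : ℤ)) =
      mk fun k => (Nat.multichoose (a + b) k : ℤ) := by
    have h1 := key a
    have h2 := key b
    have h3 := key (a + b)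
    rw [pow_add] at h3
    linear_combination (mk fun k => (Nat.multichoose (a + b) k : ℤ)) * h1 +
      (mk fun k => (Nat.multichoose (a + b) k : ℤ)) * (mk fun k => (Nat.multichoose a k : ℤ)) *
        (1 - X) ^ a * h2 -
      (mk fun k => (Nat.multichoose a k : ℤ)) * (mk fun k => (Nat.multichoose b k : ℤ)) * h3
  have := congrArg (coeff s) hmul
  simp only [coeff_mul, coeff_mk] at this
  exact_mod_cast this

/-- The number of elements of `{0, …, n - 1}` that are moved by `f`. -/
def movedCount (n : ℕ) (f : ℕ → ℕ) : ℕ :=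
  ∑ i ∈ Finset.range n, if f i = i then 0 else 1

/-- `f` is an involution on `{0, …, n - 1}` with `s` cycles of length two. -/
def IsMuInvolution (n s : ℕ) (f : ℕ → ℕ) : Prop :=
  (∀ i < n, f (f i) = i) ∧ movedCount n f = 2 * s

lemma autMuCount_eq (T : PTree) (s : ℕ) :
    autMuCount T s = (isoFuns T T).countP fun f => decide (IsMuInvolution T.size s f) := by
  unfold autMuCount
  congr 1
  funext f
  have h : (List.range T.size).countP (fun i => !(f i == i)) = movedCount T.size f := by
    unfold movedCount
    generalize T.size = n
    induction n with
    | zero => simp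
    | succ n ih =>
      rw [List.range_succ, List.countP_append, ih, Finset.sum_range_succ]
      by_cases hn : f n = n <;> simp [hn]
  rw [h, Bool.eq_iff_iff, decide_eq_true_iff]
  simp [IsMuInvolution]

lemma even_movedCount {n : ℕ} {f : ℕ → ℕ} (hlt : ∀ i < n, f i < n)
    (hinv : ∀ i < n, f (f i) = i) : Even (movedCount n f) := by
  rw [← ZMod.natCast_eq_zero_iff_even, movedCount, Nat.cast_sum]
  refine Finset.sum_involution (fun i _ => f i) (fun i hi => ?_) (fun i _ h => ?_)
    (fun i hi => ?_) fun i hi => hinv i (Finset.mem_range.1 hi)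
  · simp only [hinv i (Finset.mem_range.1 hi), eq_comm (a := i)]
    split_ifs <;> decide
  · contrapose! h
    simp [h]
  · exact Finset.mem_range.2 (hlt i (Finset.mem_range.1 hi))

lemma movedCount_le (n : ℕ) (f : ℕ → ℕ) : movedCount n f ≤ n := by
  refine (Finset.sum_le_card_nsmul _ _ 1 fun i _ => ?_).trans (by simp)
  split_ifs <;> simp

lemma autMuCount_eq_zero {T : PTree} {s : ℕ} (hs : T.size < 2 * s) : autMuCount T s = 0 := by
  rw [autMuCount_eq, List.countP_eq_zero]
  intro f _ hf
  have h := (of_decide_eq_true hf).2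
  have := movedCount_le T.size f
  omega

lemma movedCount_joinFun (m k : ℕ) (g h : ℕ → ℕ) :
    movedCount (m + k) (joinFun m m g h) = movedCount m g + movedCount k h := by
  unfold movedCount
  rw [Finset.sum_range_add]
  congr 1
  · refine Finset.sum_congr rfl fun i hi => ?_
    rw [joinFun_left (Finset.mem_range.1 hi)]
  · refine Finset.sum_congr rfl fun i _ => ?_
    simp only [joinFun_right, add_comm (h i), Nat.add_left_cancel_iff]

lemma movedCount_swapFun {m k : ℕ} {g h : ℕ → ℕ} (hh : ∀ i < k, h i < m) :
    movedCount (m + k) (swapFun m m g h) = m + k := by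
  unfold movedCount
  rw [Finset.sum_congr rfl (g := fun _ => 1), Finset.sum_const, Finset.card_range, smul_eq_mul,
    mul_one]
  intro i hi
  rw [Finset.mem_range] at hi
  refine if_neg ?_
  rcases lt_or_ge i m with him | him
  · rw [swapFun_left him]; omega
  · obtain ⟨j, rfl⟩ := Nat.exists_eq_add_of_le him
    have := hh j (by omega)
    rw [swapFun_right]; omega

lemma isMuInvolution_joinFun {l r : PTree} {g h : ℕ → ℕ} {s : ℕ} (hg : g ∈ isoFuns l l)
    (hh : h ∈ isoFuns r r)
    (hf : IsMuInvolution (l.size + r.size) s (joinFun l.size l.size g h)) :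
    ∃ p ∈ Finset.HasAntidiagonal.antidiagonal s,
      IsMuInvolution l.size p.1 g ∧ IsMuInvolution r.size p.2 h := by
  obtain ⟨hinv, hmoved⟩ := hf
  have hg' : ∀ i < l.size, g (g i) = i := fun i hi => by
    have := hinv i (by omega)
    rwa [joinFun_left hi, joinFun_left (lt_size_of_mem_isoFuns hg hi)] at this
  have hh' : ∀ i < r.size, h (h i) = i := fun i hi => by
    have := hinv (l.size + i) (by omega)
    rw [joinFun_right, add_comm (h i), joinFun_right] at this
    omega
  obtain ⟨a, ha⟩ := even_movedCount (fun _ => lt_size_of_mem_isoFuns hg) hg'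
  obtain ⟨b, hb⟩ := even_movedCount (fun _ => lt_size_of_mem_isoFuns hh) hh'
  rw [movedCount_joinFun] at hmoved
  refine ⟨(a, b), ?_, ⟨hg', by omega⟩, hh', by omega⟩
  rw [Finset.HasAntidiagonal.mem_antidiagonal]
  omega

/-- An isomorphism has at most one two-sided inverse in the list of isomorphisms. -/
lemma countP_swapFun_le_one {l r : PTree} {g : ℕ → ℕ} (s : ℕ) :
    (isoFuns r l).countP
      (fun h => decide (IsMuInvolution (l.size + r.size) s (swapFun l.size l.size g h))) ≤ 1 := by
  have key : ∀ h ∈ isoFuns r l, IsMuInvolution (l.size + r.size) s (swapFun l.size l.size g h) →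
      (∀ i < l.size, h (g i) = i) ∧ ∀ j < r.size, g (h j) = j := by
    rintro h hh ⟨hinv, -⟩
    constructor
    · intro i hi
      have := hinv i (by omega)
      rwa [swapFun_left hi, add_comm, swapFun_right] at this
    · intro j hj
      have := hinv (l.size + j) (by omega)
      rw [swapFun_right, swapFun_left (lt_size_of_mem_isoFuns hh hj)] at this
      omega
  by_cases hex : ∃ k ∈ isoFuns r l, IsMuInvolution (l.size + r.size) s
      (swapFun l.size l.size g k)
  · obtain ⟨k, hk, hkf⟩ := hex
    refine le_trans (countP_le_of_imp fun h hh hf j hj => ?_) (countP_isoFuns_eqOn_le_one r l k)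
    have h1 := (key h hh hf).2 j hj
    have h2 := (key k hk hkf).1 (h j) (lt_size_of_mem_isoFuns hh hj)
    rw [h1] at h2
    exact h2.symm
  · refine le_trans (le_of_eq (List.countP_eq_zero.2 fun h hh hf => ?_)) zero_le_one
    exact hex ⟨h, hh, of_decide_eq_true hf⟩

lemma countP_swap_le (l r : PTree) (s : ℕ) :
    ((isoFuns l r).flatMap fun g => (isoFuns r l).map (swapFun l.size l.size g)).countP
      (fun f => decide (IsMuInvolution (l.size + r.size) s f)) ≤
    if s = l.size then (isoFuns l r).length else 0 := by
  split_ifs with hs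
  · rw [List.countP_flatMap]
    refine (List.sum_le_card_nsmul _ 1 ?_).trans (by simp)
    intro x hx
    simp only [List.mem_map, Function.comp_apply] at hx
    obtain ⟨g, -, rfl⟩ := hx
    rw [List.countP_map]
    exact countP_swapFun_le_one s
  · refine le_of_eq (List.countP_eq_zero.2 fun f hf hf' => hs ?_)
    simp only [List.mem_flatMap, List.mem_map] at hf
    obtain ⟨g, hg, h, hh, rfl⟩ := hf
    have h1 := (of_decide_eq_true hf').2
    have h2 := size_eq_of_mem_isoFuns hg
    rw [movedCount_swapFun fun _ => lt_size_of_mem_isoFuns hh] at h1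
    omega

lemma autMuCount_node_le (l r : PTree) (s : ℕ) :
    autMuCount (node l r) s ≤
      ∑ p ∈ Finset.HasAntidiagonal.antidiagonal s, autMuCount l p.1 * autMuCount r p.2 +
      if s = l.size then (isoFuns l r).length else 0 := by
  rw [autMuCount_eq, isoFuns_node_node, List.countP_append]
  refine add_le_add ?_ (countP_swap_le l r s)
  simp only [autMuCount_eq]
  exact countP_flatMap_map_le _ _ _ _ _ (fun (p : ℕ × ℕ) g => IsMuInvolution l.size p.1 g)
    (fun (p : ℕ × ℕ) h => IsMuInvolution r.size p.2 h) fun g hg h hh hf => isMuInvolution_joinFun hg hh hf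

lemma autMuCount_leaf_le (s : ℕ) : autMuCount leaf s ≤ Nat.multichoose 0 s := by
  cases s with
  | zero => exact (List.countP_le_length).trans (by simp [isoFuns])
  | succ s => rw [autMuCount_eq_zero (by simp only [size]; omega)]; exact Nat.zero_le _

/-- The gap between the two sides of the convolution bound at `s = l.size` leaves room for the
involutions exchanging the two branches. -/
lemma sum_autMuCount_add_length_le {l r : PTree} (hl : l ≠ leaf) {f : ℕ → ℕ}
    (hf : f ∈ isoFuns l r) (ihl : ∀ s, autMuCount l s ≤ Nat.multichoose l.cherries s)
    (ihr : ∀ s, autMuCount r s ≤ Nat.multichoose r.cherries s) :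
    ∑ p ∈ Finset.HasAntidiagonal.antidiagonal l.size, autMuCount l p.1 * autMuCount r p.2 +
      (isoFuns l r).length ≤ Nat.multichoose (l.cherries + r.cherries) l.size := by
  have hsize := size_eq_of_mem_isoFuns hf
  have hch := cherries_eq_of_mem_isoFuns hf
  have hpos := size_pos l
  have hlen : (isoFuns l r).length ≤ 2 * Nat.multichoose l.cherries l.size := by
    have h1 := two_mul_length_isoFuns_le hl r
    have h2 := four_pow_le_multichoose (one_le_cherries hl) (two_mul_cherries_le_size l)
    omega
  rw [← sum_antidiagonal_multichoose]
  have hbound : ∀ p : ℕ × ℕ, autMuCount l p.1 * autMuCount r p.2 +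
      ((if p = (0, l.size) then Nat.multichoose l.cherries l.size else 0) +
       (if p = (l.size, 0) then Nat.multichoose l.cherries l.size else 0)) ≤
      Nat.multichoose l.cherries p.1 * Nat.multichoose r.cherries p.2 := by
    intro p
    by_cases h1 : p = (0, l.size)
    · have hne : p ≠ (l.size, 0) := by rw [h1]; simp [hpos.ne']
      rw [if_pos h1, if_neg hne, h1, autMuCount_eq_zero (T := r) (s := l.size) (by omega), ← hch]
      simp [Nat.multichoose_zero_right]
    · by_cases h2 : p = (l.size, 0)
      · rw [if_neg h1, if_pos h2, h2, autMuCount_eq_zero (T := l) (s := l.size) (by omega)]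
        simp [Nat.multichoose_zero_right]
      · rw [if_neg h1, if_neg h2]
        exact Nat.mul_le_mul (ihl _) (ihr _)
  refine le_trans ?_ (Finset.sum_le_sum fun p _ => hbound p)
  rw [Finset.sum_add_distrib, Finset.sum_add_distrib, Finset.sum_ite_eq', Finset.sum_ite_eq',
    if_pos (by simp), if_pos (by simp)]
  omega

lemma autMuCount_le_multichoose (T : PTree) (s : ℕ) :
    autMuCount T s ≤ Nat.multichoose T.cherries s := by
  induction T generalizing s with
  | leaf => exact autMuCount_leaf_le s
  | node l r ihl ihr =>
    have hrec := autMuCount_node_le l r s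
    have hsum : ∑ p ∈ Finset.HasAntidiagonal.antidiagonal s, autMuCount l p.1 * autMuCount r p.2 ≤
        Nat.multichoose (l.cherries + r.cherries) s := by
      rw [← sum_antidiagonal_multichoose]
      exact Finset.sum_le_sum fun p _ => Nat.mul_le_mul (ihl _) (ihr _)
    by_cases hlr : l = leaf ∧ r = leaf
    · obtain ⟨rfl, rfl⟩ := hlr
      simp only [cherries, Nat.multichoose_one, add_zero, size, isoFuns, List.length_singleton]
        at hrec hsum ⊢
      rcases s with _ | s
      · simp only [Nat.multichoose_zero_right] at hsum
        simp only [zero_ne_one, if_false] at hrec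
        omega
      · rw [Nat.multichoose_zero_succ] at hsum
        refine hrec.trans ((add_le_add_left hsum _).trans ?_)
        by_cases h0 : s = 0 <;> simp [h0]
    · rw [cherries_node_of_ne hlr]
      rcases (isoFuns l r).eq_nil_or_concat with hnil | ⟨L, f, hL⟩
      · simp only [hnil, List.length_nil, ite_self] at hrec
        omega
      · have hf : f ∈ isoFuns l r := by simp [hL]
        have hl : l ≠ leaf := fun h => hlr ⟨h, (leaf_iff_of_mem_isoFuns hf).1 h⟩
        split_ifs at hrec with hs
        · subst hs
          exact hrec.trans (sum_autMuCount_add_length_le hl hf ihl ihr)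
        · omega

end PTree

open PTree in
/-- Lemma 2 (upper bound): `|A(T)_{μ(s)}| ≤ binom(c(T)+s-1, s)` where `μ(s) = 2^s 1^(n-2s)`. -/
theorem autMuCount_le_choose (T : PTree) (n s : ℕ)
    (hn : T.size = n) (hs : 2 * s ≤ n) :
    autMuCount T s ≤ Nat.choose (T.cherries + s - 1) s := by
  rw [← Nat.multichoose_eq]
  exact autMuCount_le_multichoose T s
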